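/- For every fixed x < 0, the implied volatility tends to infinity as the price approaches its upper bound: lim_{p → (e^{x/2})⁻} V(x,p) = ∞, where V(x,p) is the unique v > 0 with c(x,v) = p. -/

import Mathlib

open Real Set Filter

/-- The standard normal cumulative distribution function Φ. -/
noncomputable def stdNormalCDF (y : ℝ) : ℝ :=
  (Real.sqrt (2 * Real.pi))⁻¹ * ∫ t in Set.Iic y, Real.exp (-t ^ 2 / 2)

/-- The normalized Black-Scholes call price
`c(x,v) = e^{x/2} Φ(x/v + v/2) − e^{−x/2} Φ(x/v − v/2)`. -/
noncomputable def normCall (x v : ℝ) : ℝ :=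
  Real.exp (x / 2) * stdNormalCDF (x / v + v / 2) -
    Real.exp (-x / 2) * stdNormalCDF (x / v - v / 2)

theorem integrable_exp_neg_sq_div_two :
    MeasureTheory.Integrable fun t : ℝ => Real.exp (-t ^ 2 / 2) := by
  refine (integrable_exp_neg_mul_sq (b := 1 / 2) (by norm_num)).congr (.of_forall fun t => ?_)
  simp only
  congr 1
  ring

theorem integral_exp_neg_sq_div_two :
    ∫ t : ℝ, Real.exp (-t ^ 2 / 2) = Real.sqrt (2 * Real.pi) := by
  have h := integral_gaussian (1 / 2)
  rw [show Real.pi / (1 / 2) = 2 * Real.pi by ring] at h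
  rw [← h]
  congr 1 with t
  congr 1
  ring

theorem stdNormalCDF_nonneg (y : ℝ) : 0 ≤ stdNormalCDF y :=
  mul_nonneg (by positivity) (MeasureTheory.integral_nonneg fun _ => (Real.exp_pos _).le)

theorem stdNormalCDF_mono : Monotone stdNormalCDF := fun _ _ hab =>
  mul_le_mul_of_nonneg_left
    (MeasureTheory.setIntegral_mono_set integrable_exp_neg_sq_div_two.integrableOn
      (.of_forall fun _ => (Real.exp_pos _).le) (Set.Iic_subset_Iic.2 hab).eventuallyLE)
    (by positivity)

theorem stdNormalCDF_lt_one (y : ℝ) : stdNormalCDF y < 1 := by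
  have hsplit := MeasureTheory.integral_add_compl (measurableSet_Iic (a := y))
    integrable_exp_neg_sq_div_two
  rw [integral_exp_neg_sq_div_two, Set.compl_Iic] at hsplit
  have htail : 0 < ∫ t in Set.Ioi y, Real.exp (-t ^ 2 / 2) := by
    rw [MeasureTheory.setIntegral_pos_iff_support_of_nonneg_ae
      (.of_forall fun _ => (Real.exp_pos _).le) integrable_exp_neg_sq_div_two.integrableOn]
    have hsupp : Function.support (fun t : ℝ => Real.exp (-t ^ 2 / 2)) = Set.univ :=
      Set.eq_univ_of_forall fun t => (Real.exp_pos _).ne'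
    simp [hsupp]
  rw [stdNormalCDF, inv_mul_lt_one₀ (by positivity)]
  linarith

/-- For `x ≤ 0` the call price with volatility at most `M` is bounded away from `e^{x/2}`. -/
theorem normCall_le_of_le {x v M : ℝ} (hx : x ≤ 0) (hv : 0 < v) (hvM : v ≤ M) :
    normCall x v ≤ Real.exp (x / 2) * stdNormalCDF (M / 2) := by
  have harg : x / v + v / 2 ≤ M / 2 := by
    linarith [div_nonpos_of_nonpos_of_nonneg hx hv.le]
  have hfirst := mul_le_mul_of_nonneg_left (stdNormalCDF_mono harg) (Real.exp_pos (x / 2)).le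
  have hsecond := mul_nonneg (Real.exp_pos (-x / 2)).le (stdNormalCDF_nonneg (x / v - v / 2))
  unfold normCall
  linarith

/-- For fixed `x < 0`, the implied volatility `V(x,p)` (the unique `v > 0` with
`c(x,v) = p`) tends to `∞` as the price `p` approaches its upper bound `e^{x/2}` from
below. -/
theorem impliedVol_tendsto_atTop (x : ℝ) (hx : x < 0) (V : ℝ → ℝ)
    (hV : ∀ p : ℝ, 0 < p → p < Real.exp (x / 2) → 0 < V p ∧ normCall x (V p) = p) :
    Filter.Tendsto V
      (nhdsWithin (Real.exp (x / 2)) (Set.Ioo 0 (Real.exp (x / 2)))) Filter.atTop := by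
  refine Filter.tendsto_atTop.2 fun M => ?_
  have hlt : Real.exp (x / 2) * stdNormalCDF (M / 2) < Real.exp (x / 2) :=
    mul_lt_of_lt_one_right (Real.exp_pos _) (stdNormalCDF_lt_one _)
  filter_upwards [self_mem_nhdsWithin, mem_nhdsWithin_of_mem_nhds (Ioi_mem_nhds hlt)] with p hp hMp
  obtain ⟨hpos, heq⟩ := hV p hp.1 hp.2
  by_contra! hVM
  exact (normCall_le_of_le hx.le hpos hVM.le).not_gt (heq.symm ▸ hMp)
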